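/- arXiv:2101.05952 — 3 statements merged into one kernel-verified Lean document; each statement's English description precedes it below -/
import Mathlib

section
/- Fix the three-tier latency model. Let m ≥ 1 and let h : Fin m → Tier be the tiers assigned to the direct predecessors of a vertex, and let M = max_{k} h(k). Then for every tier l with M < l, one has L(M) < L(l), where L(l) = t(l) + Σ_{k=1}^{m} τ(h(k), l). Consequently, every tier minimizing the total latency L is ≤ M; i.e., the optimal tier of a vertex never strictly precedes (in the order device > edge > cloud) the maximum of its direct predecessors' tiers. -/
/-- A transmission delay on three tiers is monotone in the receiving tier above the sender. -/
theorem delay_le_delay_of_le_of_lt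
    {τ : Fin 3 → Fin 3 → ℝ}
    (hsymm : ∀ a b : Fin 3, τ a b = τ b a)
    (hdiag : ∀ a : Fin 3, τ a a = 0)
    (hde : 0 ≤ τ 2 1)
    (hec : 0 ≤ τ 1 0)
    (hecdc : τ 1 0 ≤ τ 2 0)
    {a b c : Fin 3} (hab : a ≤ b) (hbc : b < c) : τ a b ≤ τ a c := by
  have h01 := hsymm 0 1
  have h02 := hsymm 0 2
  have h12 := hsymm 1 2
  have h0 := hdiag 0
  have h1 := hdiag 1
  fin_cases a <;> fin_cases b <;> fin_cases c <;> simp at hab hbc ⊢ <;> linarith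

/-- **Proposition 1 (potential tier).**
Tiers are `Fin 3` with `cloud = 0 < edge = 1 < device = 2`.  With a strictly
monotone processing time `t`, a symmetric transmission delay `τ` vanishing on
equal tiers and satisfying `0 < τ(device,edge) < τ(edge,cloud) ≤ τ(device,cloud)`,
and `M` the maximum tier among the `m ≥ 1` direct predecessors, the total latency
`L l = t l + Σ_k τ (h k) l` satisfies `L M < L l` whenever `M < l`; hence any
latency-minimizing tier is `≤ M`. -/
theorem optimal_tier_le_max_pred
    (t : Fin 3 → ℝ) (τ : Fin 3 → Fin 3 → ℝ)
    (ht : StrictMono t)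
    (hsymm : ∀ a b : Fin 3, τ a b = τ b a)
    (hdiag : ∀ a : Fin 3, τ a a = 0)
    (hde : 0 < τ 2 1)
    (hdeec : τ 2 1 < τ 1 0)
    (hecdc : τ 1 0 ≤ τ 2 0)
    (m : ℕ) (hm : 1 ≤ m) (h : Fin m → Fin 3)
    (L : Fin 3 → ℝ)
    (hL : ∀ l : Fin 3, L l = t l + ∑ k : Fin m, τ (h k) l)
    (M : Fin 3)
    (hM : M = Finset.univ.sup' (Finset.univ_nonempty_iff.mpr ⟨⟨0, hm⟩⟩) h) :
    (∀ l : Fin 3, M < l → L M < L l) ∧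
    (∀ l : Fin 3, (∀ l' : Fin 3, L l ≤ L l') → l ≤ M) := by
  have hlt : ∀ l : Fin 3, M < l → L M < L l := by
    intro l hl
    rw [hL, hL]
    refine add_lt_add_of_lt_of_le (ht hl) (Finset.sum_le_sum fun k _ ↦ ?_)
    have hk : h k ≤ M := hM ▸ Finset.le_sup' h (Finset.mem_univ k)
    exact delay_le_delay_of_le_of_lt hsymm hdiag hde.le (hde.trans hdeec).le hecdc hk hl
  exact ⟨hlt, fun l hl ↦ not_lt.mp fun hMl ↦ (hlt l hMl).not_ge (hl M)⟩
end

section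
/- Let S, F, xα, xβ : ℕ with 0 < S, S ≤ F, and xα < xβ. Then ⋃_{x ∈ Set.Ico xα xβ} Set.Ico (S·x) (S·x + F) = Set.Ico (S·xα) (S·(xβ − 1) + F) as subsets of ℕ. That is, the padded input positions needed to compute the contiguous output positions [xα, xβ) of a convolutional layer with stride S and filter width F form exactly the contiguous interval [S·xα, S·(xβ − 1) + F). -/
/-- **Correctness of the reverse tile calculation (Equation (4)),
one spatial dimension.**  For stride `0 < S ≤ F` (filter width) and an output
tile with horizontal extent `[xα, xβ)` with `xα < xβ`, the padded input
positions needed to compute the tile form exactly the contiguous interval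
`[S·xα, S·(xβ − 1) + F)`. -/
theorem rtc_union_of_windows
    (S F xα xβ : ℕ) (hS : 0 < S) (hSF : S ≤ F) (hx : xα < xβ) :
    ⋃ x ∈ Set.Ico xα xβ, Set.Ico (S * x) (S * x + F)
      = Set.Ico (S * xα) (S * (xβ - 1) + F) := by
  ext y
  simp only [Set.mem_iUnion, Set.mem_Ico, exists_prop]
  constructor
  · rintro ⟨x, ⟨hαx, hxβ⟩, hxy, hyx⟩
    have h₁ : S * xα ≤ S * x := Nat.mul_le_mul_left S hαx
    have h₂ : S * x ≤ S * (xβ - 1) := Nat.mul_le_mul_left S (by omega)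
    omega
  · rintro ⟨hαy, hyβ⟩
    by_cases hy : S * (xβ - 1) ≤ y
    · exact ⟨xβ - 1, ⟨by omega, by omega⟩, hy, hyβ⟩
    · have h_div : y / S < xβ - 1 := Nat.div_lt_of_lt_mul (not_le.mp hy)
      have h_lt : y < S * (y / S) + S := Nat.lt_mul_div_succ y hS
      refine ⟨y / S, ⟨?_, by omega⟩, Nat.mul_div_le y S, by omega⟩
      rwa [Nat.le_div_iff_mul_le hS, mul_comm]
end

section
/- Let k : ℕ and for each i ∈ {1, …, k} let S_i, F_i : ℕ with 0 < S_i and S_i ≤ F_i. Given a_{k+1}, b_{k+1} : ℕ with a_{k+1} < b_{k+1}, define recursively a_i = S_i · a_{i+1} and b_i = S_i · (b_{i+1} − 1) + F_i for i = k, k−1, …, 1. Then for every i ∈ {1, …, k}: (1) a_i < b_i, and (2) ⋃_{x ∈ Set.Ico a_{i+1} b_{i+1}} Set.Ico (S_i·x) (S_i·x + F_i) = Set.Ico a_i b_i as subsets of ℕ. Hence the interval [a_1, b_1) at the first layer is exactly the set of padded input positions needed, through all k layers, to compute the output positions [a_{k+1}, b_{k+1}). -/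
/-- The reverse tile of a nonempty tile is nonempty. -/
theorem reverse_tile_lt {s f a b : ℕ} (hf : 0 < f) (hab : a < b) :
    s * a < s * (b - 1) + f :=
  (Nat.mul_le_mul_left s (Nat.le_sub_one_of_lt hab)).trans_lt (Nat.lt_add_of_pos_right hf)

/-- When the stride is positive and at most the filter width, the windows of the positions in
`[a, b)` cover exactly the reverse tile. -/
theorem iUnion_window_eq_Ico {s f a b : ℕ} (hs : 0 < s) (hsf : s ≤ f) (hab : a < b) :
    (⋃ x ∈ Set.Ico a b, Set.Ico (s * x) (s * x + f)) = Set.Ico (s * a) (s * (b - 1) + f) := by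
  ext y
  simp only [Set.mem_iUnion, Set.mem_Ico, exists_prop]
  constructor
  · rintro ⟨x, ⟨hax, hxb⟩, hxy, hyx⟩
    have hleft := Nat.mul_le_mul_left s hax
    have hright := Nat.mul_le_mul_left s (Nat.le_sub_one_of_lt hxb)
    omega
  · rintro ⟨hay, hyb⟩
    rcases lt_or_ge (y / s) b with hlt | hge
    · have hmod := Nat.mod_lt y hs
      have hdiv := Nat.div_add_mod y s
      exact ⟨y / s, ⟨(Nat.le_div_iff_mul_le hs).2 (by rwa [mul_comm]), hlt⟩, by omega, by omega⟩
    · have hby := (Nat.mul_le_mul_left s ((Nat.sub_le b 1).trans hge)).trans (Nat.mul_div_le y s)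
      exact ⟨b - 1, ⟨by omega, by omega⟩, hby, hyb⟩

/-- **Correctness of the vertical separation module (Algorithm 2),
one spatial dimension.**  For `k` convolutional layers with strides
`0 < S i ≤ F i` (filter widths), starting from a final output tile
`[a (k+1), b (k+1))` with `a (k+1) < b (k+1)` and applying the reverse tile
calculation `a i = S i * a (i+1)`, `b i = S i * (b (i+1) - 1) + F i`
layer by layer, every intermediate tile `[a i, b i)` is nonempty and is
exactly the set of padded input positions of layer `i` needed to compute the
tile `[a (i+1), b (i+1))`. -/
theorem vsm_fused_tiles_correct
    (k : ℕ) (S F : ℕ → ℕ)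
    (hS : ∀ i, 1 ≤ i → i ≤ k → 0 < S i)
    (hSF : ∀ i, 1 ≤ i → i ≤ k → S i ≤ F i)
    (a b : ℕ → ℕ)
    (hk1 : a (k + 1) < b (k + 1))
    (ha : ∀ i, 1 ≤ i → i ≤ k → a i = S i * a (i + 1))
    (hb : ∀ i, 1 ≤ i → i ≤ k → b i = S i * (b (i + 1) - 1) + F i) :
    ∀ i, 1 ≤ i → i ≤ k →
      a i < b i ∧
      (⋃ x ∈ Set.Ico (a (i + 1)) (b (i + 1)),
          Set.Ico (S i * x) (S i * x + F i)) = Set.Ico (a i) (b i) := by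
  have hF : ∀ i, 1 ≤ i → i ≤ k → 0 < F i := fun i h1 h2 => (hS i h1 h2).trans_le (hSF i h1 h2)
  have hlt : ∀ i, i ≤ k + 1 → 1 ≤ i → a i < b i := by
    intro i hi
    induction hi using Nat.decreasingInduction with
    | self => exact fun _ => hk1
    | of_succ j hj ih =>
      intro h1
      have hjk := Nat.le_of_lt_succ hj
      rw [ha j h1 hjk, hb j h1 hjk]
      exact reverse_tile_lt (hF j h1 hjk) (ih (by omega))
  intro i h1 h2
  refine ⟨hlt i (by omega) h1, ?_⟩
  rw [ha i h1 h2, hb i h1 h2]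
  exact iUnion_window_eq_Ico (hS i h1 h2) (hSF i h1 h2) (hlt (i + 1) (by omega) (by omega))
end
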